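/- Let L_t be a time-dependent GKSL generator with Hermitian jump operators satisfying Condition Q, with t ↦ H_t continuous. Then the following are equivalent: (1) C^Int \ C^Sch ≠ ∅; (2) there exists a time-dependent steady state, i.e., there exist a density matrix ρ0, a solution ρ_t with ρ_0 = ρ0, and a family of density matrices ρ*_t such that lim_{t→∞} (ρ_t − ρ*_t) = 0 and ρ*_t does not converge, as t → ∞, to any fixed density matrix. -/

import Mathlib

open Matrix Filter
open scoped ComplexOrder

attribute [local instance] Matrix.normedAddCommGroup Matrix.normedSpace

noncomputable def hsNorm {d : ℕ} (A : Matrix (Fin d) (Fin d) ℂ) : ℝ :=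
  Real.sqrt ((Matrix.trace (Aᴴ * A)).re)

noncomputable def opNorm2 {d : ℕ}
    (Φ : Matrix (Fin d) (Fin d) ℂ → Matrix (Fin d) (Fin d) ℂ) : ℝ :=
  sSup {r : ℝ | ∃ A, hsNorm A = 1 ∧ r = hsNorm (Φ A)}

noncomputable def gksl {d M : ℕ} (H : ℝ → Matrix (Fin d) (Fin d) ℂ)
    (L : Fin M → ℝ → Matrix (Fin d) (Fin d) ℂ) (t : ℝ)
    (ρ : Matrix (Fin d) (Fin d) ℂ) : Matrix (Fin d) (Fin d) ℂ :=
  (-Complex.I) • (H t * ρ - ρ * H t) +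
    ∑ m : Fin M, (L m t * ρ * L m t - (2⁻¹ : ℂ) • ((L m t) ^ 2 * ρ + ρ * (L m t) ^ 2))

def CondQ {d : ℕ}
    (ℒ : ℝ → Matrix (Fin d) (Fin d) ℂ → Matrix (Fin d) (Fin d) ℂ) : Prop :=
  (∀ t0 : ℝ, 0 ≤ t0 → ∀ ε > (0 : ℝ), ∃ δ > (0 : ℝ), ∀ t : ℝ, 0 ≤ t → |t - t0| < δ →
      opNorm2 (fun A => ℒ t A - ℒ t0 A) < ε) ∧
  (∃ M > (0 : ℝ), ∀ t : ℝ, 0 ≤ t → opNorm2 (ℒ t) ≤ M) ∧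
  (∀ ε > (0 : ℝ), ∀ δ > (0 : ℝ), ∀ t0 : ℝ, 0 ≤ t0 →
    ∃ ts : ℕ → ℝ, (∀ n, 0 ≤ ts n) ∧ (∀ n, ts n + δ < ts (n + 1)) ∧
      ∀ n, ∀ t ∈ Set.Icc (0 : ℝ) δ,
        opNorm2 (fun A => ℒ (ts n + t) A - ℒ (t0 + t) A) < ε)

def IsDensity {d : ℕ} (ρ : Matrix (Fin d) (Fin d) ℂ) : Prop :=
  ρ.PosSemidef ∧ Matrix.trace ρ = 1


noncomputable def hsNormSq {d : ℕ} (A : Matrix (Fin d) (Fin d) ℂ) : ℝ :=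
  (Matrix.trace (Aᴴ * A)).re

noncomputable def opNorm2' {d : ℕ}
    (Φ : Matrix (Fin d) (Fin d) ℂ → Matrix (Fin d) (Fin d) ℂ) : ℝ :=
  sSup {r : ℝ | ∃ A, hsNorm A = 1 ∧ Matrix.trace A = 0 ∧ r = hsNorm (Φ A)}

/-- The adjoint operation on a time-dependent family of matrices:
`ad(A)_t = i[H_t, A_t] + ∂_t A_t`. -/
noncomputable def adOp {d : ℕ} (H : ℝ → Matrix (Fin d) (Fin d) ℂ)
    (A : ℝ → Matrix (Fin d) (Fin d) ℂ) : ℝ → Matrix (Fin d) (Fin d) ℂ :=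
  fun t => Complex.I • (H t * A t - A t * H t) + deriv A t

/-- `n`-fold application of the adjoint operation to a family of matrices. -/
noncomputable def adPow {d : ℕ} (H : ℝ → Matrix (Fin d) (Fin d) ℂ) :
    ℕ → (ℝ → Matrix (Fin d) (Fin d) ℂ) → (ℝ → Matrix (Fin d) (Fin d) ℂ)
  | 0, A => A
  | n + 1, A => adOp H (adPow H n A)



section Abstract
variable {E : Type*} [NormedAddCommGroup E]

/-- If a solution of a recurrent linear ODE converges, its limit is a zero of the generator. -/
theorem aux_limit_zero [NormedSpace ℝ E] (L : ℝ → E →L[ℝ] E) (M : ℝ) (hM : 0 < M)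
    (hLM : ∀ t, 0 ≤ t → ‖L t‖ ≤ M)
    (hLc : ∀ t0 : ℝ, 0 ≤ t0 → ∀ ε > (0 : ℝ), ∃ δ > (0 : ℝ), ∀ t : ℝ, 0 ≤ t → |t - t0| < δ →
      ‖L t - L t0‖ < ε)
    (hrec : ∀ ε > (0 : ℝ), ∀ δ > (0 : ℝ), ∀ t0 : ℝ, 0 ≤ t0 → ∀ T : ℝ,
      ∃ τ : ℝ, T ≤ τ ∧ 0 ≤ τ ∧ ∀ t ∈ Set.Icc (0 : ℝ) δ, ‖L (τ + t) - L (t0 + t)‖ < ε)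
    (A : ℝ → E) (hA : ∀ t, 0 ≤ t → HasDerivAt A (L t (A t)) t) (Z : E)
    (hZ : Tendsto A atTop (nhds Z)) (s : ℝ) (hs : 0 ≤ s) : L s Z = 0 := by
  have key : ∀ ε > (0 : ℝ), ‖L s Z‖ ≤ ε * (2 + M + 2 * ‖Z‖) := by
    intro ε hε
    obtain ⟨δ, hδ, hδL⟩ := hLc s hs ε hε
    set r := δ / 2 with hr
    have hr0 : 0 < r := by positivity
    have hη : 0 < min ε (r * ε) := by positivity
    obtain ⟨T, hT⟩ := (Metric.tendsto_atTop.1 hZ) _ hη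
    obtain ⟨τ, hTτ, hτ0, hτ⟩ := hrec ε hε r hr0 s hs T
    have hclose : ∀ u, τ ≤ u → ‖A u - Z‖ < min ε (r * ε) := by
      intro u hu
      have := hT u (hTτ.trans hu)
      rwa [dist_eq_norm] at this
    have hder : ∀ u ∈ Set.Icc (0 : ℝ) r,
        HasDerivWithinAt (fun u => A (τ + u) - u • L s Z)
          (L (τ + u) (A (τ + u)) - L s Z) (Set.Icc 0 r) u := by
      intro u hu
      have h1 : HasDerivAt (fun u => A (τ + u)) (L (τ + u) (A (τ + u))) u := by
        have := (hA (τ + u) (add_nonneg hτ0 hu.1)).comp_const_add τ u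
        exact this
      have h2 : HasDerivAt (fun u : ℝ => u • L s Z) (L s Z) u := by
        simpa using (hasDerivAt_id u).smul_const (L s Z)
      exact (h1.sub h2).hasDerivWithinAt
    have hbd : ∀ u ∈ Set.Ico (0 : ℝ) r,
        ‖L (τ + u) (A (τ + u)) - L s Z‖ ≤ ε * (M + 2 * ‖Z‖) := by
      intro u hu
      have e : L (τ + u) (A (τ + u)) - L s Z = L (τ + u) (A (τ + u) - Z)
          + (L (τ + u) - L (s + u)) Z + (L (s + u) - L s) Z := by
        simp only [map_sub, _root_.sub_apply]; abel
      have b1 : ‖L (τ + u) (A (τ + u) - Z)‖ ≤ M * ε := by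
        refine ((L (τ + u)).le_opNorm _).trans ?_
        have := (hclose (τ + u) (by linarith [hu.1])).le.trans (min_le_left _ _)
        exact mul_le_mul (hLM _ (add_nonneg hτ0 hu.1)) this (norm_nonneg _) hM.le
      have b2 : ‖(L (τ + u) - L (s + u)) Z‖ ≤ ε * ‖Z‖ := by
        refine (ContinuousLinearMap.le_opNorm _ _).trans ?_
        exact mul_le_mul_of_nonneg_right (hτ u ⟨hu.1, hu.2.le⟩).le (norm_nonneg _)
      have b3 : ‖(L (s + u) - L s) Z‖ ≤ ε * ‖Z‖ := by
        refine (ContinuousLinearMap.le_opNorm _ _).trans ?_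
        refine mul_le_mul_of_nonneg_right (hδL (s + u) (add_nonneg hs hu.1) ?_).le (norm_nonneg _)
        have := hu.1
        have := hu.2
        rw [add_sub_cancel_left, abs_of_nonneg hu.1]; linarith
      rw [e]
      refine (norm_add₃_le).trans ?_
      nlinarith
    have := norm_image_sub_le_of_norm_deriv_le_segment' hder hbd r ⟨hr0.le, le_rfl⟩
    simp only [add_zero, zero_smul, sub_zero] at this
    have h3 : r * ‖L s Z‖ ≤ r * (ε * (2 + M + 2 * ‖Z‖)) := by
      have e : r • L s Z = (A (τ + r) - Z) - (A τ - Z) - (A (τ + r) - r • L s Z - A τ) := by abel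
      have n1 := (hclose (τ + r) (by linarith)).le.trans (min_le_right _ _)
      have n2 := (hclose τ le_rfl).le.trans (min_le_right _ _)
      calc r * ‖L s Z‖ = ‖r • L s Z‖ := by rw [norm_smul, Real.norm_of_nonneg hr0.le]
        _ ≤ ‖A (τ + r) - Z‖ + ‖A τ - Z‖ + ‖A (τ + r) - r • L s Z - A τ‖ := by
          
          nth_rewrite 1 [e]
          exact (norm_sub_le _ _).trans (add_le_add (norm_sub_le _ _) le_rfl)
        _ ≤ _ := by linarith
    exact le_of_mul_le_mul_left h3 hr0
  have hpos : 0 < 2 + M + 2 * ‖Z‖ := by positivity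
  by_contra hne
  have hn : 0 < ‖L s Z‖ := norm_pos_iff.2 hne
  have := key (‖L s Z‖ / (2 * (2 + M + 2 * ‖Z‖))) (by positivity)
  have e : ‖L s Z‖ / (2 * (2 + M + 2 * ‖Z‖)) * (2 + M + 2 * ‖Z‖) = ‖L s Z‖ / 2 := by
    field_simp
  linarith

variable [InnerProductSpace ℝ E]
local notation "⟪" x "," y "⟫" => inner ℝ x y

theorem aux_N_bound (N : E →L[ℝ] E) (M : ℝ) (hM : 0 < M)
    (hsym : ∀ x y, ⟪N x, y⟫ = ⟪x, N y⟫) (hpos : ∀ x, 0 ≤ ⟪x, N x⟫)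
    (hb : ∀ x, ⟪x, N x⟫ ≤ M * ‖x‖ ^ 2) (x : E) : ‖N x‖ ^ 2 ≤ M * ⟪x, N x⟫ := by
  have h := hpos (x - M⁻¹ • N x)
  have h2 := hb (N x)
  have e : ⟪x - M⁻¹ • N x, N (x - M⁻¹ • N x)⟫
      = ⟪x, N x⟫ - 2 * M⁻¹ * ‖N x‖ ^ 2 + M⁻¹ ^ 2 * ⟪N x, N (N x)⟫ := by
    simp only [map_sub, map_smul, inner_sub_left, inner_sub_right, inner_smul_left,
      inner_smul_right, ← hsym x (N x), real_inner_self_eq_norm_sq]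
    simp
    ring
  rw [e] at h
  have h3 : M⁻¹ ^ 2 * ⟪N x, N (N x)⟫ ≤ M⁻¹ * ‖N x‖ ^ 2 := by
    calc _ ≤ M⁻¹ ^ 2 * (M * ‖N x‖ ^ 2) := by gcongr
      _ = _ := by field_simp
  have h4 : M⁻¹ * ‖N x‖ ^ 2 ≤ ⟪x, N x⟫ := by linarith
  calc ‖N x‖ ^ 2 = M * (M⁻¹ * ‖N x‖ ^ 2) := by field_simp
    _ ≤ _ := by gcongr

set_option maxHeartbeats 2000000 in
theorem aux_decay [FiniteDimensional ℝ E] (L K N W Wi : ℝ → E →L[ℝ] E) (M : ℝ) (hM : 0 < M)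
    (hLM : ∀ t, 0 ≤ t → ‖L t‖ ≤ M)
    (hLc : ∀ t0 : ℝ, 0 ≤ t0 → ∀ ε > (0 : ℝ), ∃ δ > (0 : ℝ), ∀ t : ℝ, 0 ≤ t → |t - t0| < δ →
      ‖L t - L t0‖ < ε)
    (hrec : ∀ ε > (0 : ℝ), ∀ δ > (0 : ℝ), ∀ t0 : ℝ, 0 ≤ t0 → ∀ T : ℝ,
      ∃ τ : ℝ, T ≤ τ ∧ 0 ≤ τ ∧ ∀ t ∈ Set.Icc (0 : ℝ) δ, ‖L (τ + t) - L (t0 + t)‖ < ε)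
    (hLKN : ∀ t x, L t x = K t x - N t x)
    (hK : ∀ t, 0 ≤ t → ∀ x, ⟪x, K t x⟫ = 0)
    (hsym : ∀ t, 0 ≤ t → ∀ x y, ⟪N t x, y⟫ = ⟪x, N t y⟫)
    (hpos : ∀ t, 0 ≤ t → ∀ x, 0 ≤ ⟪x, N t x⟫)
    (hWWi : ∀ t, 0 ≤ t → ∀ x, W t (Wi t x) = x)
    (hW : ∀ t, 0 ≤ t → ∀ x, ‖W t x‖ = ‖x‖) (hWi : ∀ t, 0 ≤ t → ∀ x, ‖Wi t x‖ = ‖x‖)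
    (hW0 : ∀ x, Wi 0 x = x)
    (hWc : ∀ x, ContinuousOn (fun t => W t x) (Set.Ici 0))
    (hWd : ∀ (y : ℝ → E) y' t, 0 ≤ t → HasDerivAt y y' t →
      HasDerivAt (fun s => Wi s (y s)) (Wi t (y' - K t (y t))) t)
    (V : Submodule ℝ E)
    (hV : ∀ B ∈ V, (∀ t, 0 ≤ t → N t (W t B) = 0) → B = 0)
    (A : ℝ → E) (hAV : ∀ t, 0 ≤ t → A t ∈ V)
    (hA : ∀ t, 0 ≤ t → HasDerivAt A (L t (A t)) t) : Tendsto A atTop (nhds 0) := by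
  have hLN : ∀ t, 0 ≤ t → ∀ x, ⟪x, L t x⟫ = - ⟪x, N t x⟫ := by
    intro t ht x
    rw [hLKN, inner_sub_right, hK t ht, zero_sub]
  have hNb : ∀ t, 0 ≤ t → ∀ x, ‖N t x‖ ^ 2 ≤ M * ⟪x, N t x⟫ := by
    intro t ht
    refine aux_N_bound (N t) M hM (hsym t ht) (hpos t ht) (fun x => ?_)
    have h1 := (abs_le.1 (abs_real_inner_le_norm x (L t x))).1
    have h2 := (L t).le_of_opNorm_le (hLM t ht) x
    have := hLN t ht x
    nlinarith [norm_nonneg x]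
  -- the squared norm
  set f : ℝ → ℝ := fun t => ‖A t‖ ^ 2 with hf
  have hfd : ∀ t, 0 ≤ t → HasDerivAt f (2 * ⟪A t, L t (A t)⟫) t := by
    intro t ht
    exact (hA t ht).norm_sq
  have hanti : AntitoneOn f (Set.Ici 0) := by
    refine antitoneOn_of_deriv_nonpos (convex_Ici 0)
      (fun t ht => (hfd t ht).continuousAt.continuousWithinAt) ?_ ?_
    · intro t ht
      rw [interior_Ici] at ht
      exact (hfd t (le_of_lt ht)).differentiableAt.differentiableWithinAt
    · intro t ht
      rw [interior_Ici] at ht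
      have ht' : 0 ≤ t := le_of_lt ht
      rw [(hfd t ht').deriv, hLN t ht']
      linarith [hpos t ht' (A t)]
  obtain ⟨c, hc, hfc⟩ : ∃ c, Tendsto f atTop (nhds c) ∧ ∀ t, 0 ≤ t → c ≤ f t := by
    have hg : Antitone (fun t => f (max t 0)) := fun a b hab =>
      hanti (Set.mem_Ici.2 (le_max_right _ _)) (Set.mem_Ici.2 (le_max_right _ _))
        (max_le_max_right 0 hab)
    have hbdd : BddBelow (Set.range (fun t => f (max t 0))) :=
      ⟨0, by rintro _ ⟨t, rfl⟩; positivity⟩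
    have h1 := tendsto_atTop_ciInf hg hbdd
    refine ⟨_, h1.congr' ?_, fun t ht => ?_⟩
    · filter_upwards [eventually_ge_atTop 0] with t ht
      rw [max_eq_left ht]
    · have := ciInf_le hbdd t
      rwa [max_eq_left ht] at this
  set R := ‖A 0‖ with hR
  have hAR : ∀ t, 0 ≤ t → ‖A t‖ ≤ R := by
    intro t ht
    have := hanti (Set.mem_Ici.2 le_rfl) (Set.mem_Ici.2 ht) ht
    exact (sq_le_sq₀ (norm_nonneg _) (norm_nonneg _)).1 this
  have hR0 : 0 ≤ R := norm_nonneg _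
  -- the sequence of windows
  have hseq : ∀ k : ℕ, ∃ τ : ℝ, (k : ℝ) ≤ τ ∧ 0 ≤ τ ∧ ∀ t ∈ Set.Icc (0 : ℝ) (k + 1),
      ‖L (τ + t) - L t‖ < 1 / ((k : ℝ) + 1) := by
    intro k
    obtain ⟨τ, h1, h2, h3⟩ := hrec (1 / ((k : ℝ) + 1)) (by positivity) (k + 1) (by positivity) 0
      le_rfl k
    exact ⟨τ, h1, h2, by simpa using h3⟩
  choose τ hτk hτ0 hτ using hseq
  obtain ⟨B, hBmem, φ, hφ, hB⟩ := (isCompact_closedBall (0 : E) R).tendsto_subseq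
    (x := fun k => A (τ k)) (fun k => by simpa using hAR _ (hτ0 k))
  have hτinf : Tendsto (fun k => τ (φ k)) atTop atTop :=
    (tendsto_atTop_mono hτk tendsto_natCast_atTop_atTop).comp hφ.tendsto_atTop
  have hfτ : Tendsto (fun k => f (τ (φ k))) atTop (nhds c) := hc.comp hτinf
  have hBV : B ∈ V := V.closed_of_finiteDimensional.mem_of_tendsto hB
    (Eventually.of_forall fun k => hAV _ (hτ0 _))
  have hBc : ‖B‖ ^ 2 = c := tendsto_nhds_unique ((hB.norm).pow 2) hfτ
  have hBR : ‖B‖ ≤ R := by simpa using hBmem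
  -- eventual closeness of the generators
  have hgen : ∀ T : ℝ, ∀ e > (0 : ℝ), ∀ᶠ k in atTop, ∀ s ∈ Set.Icc (0 : ℝ) T,
      ‖L (τ (φ k) + s) - L s‖ ≤ e := by
    intro T e he
    have h1 : Tendsto (fun k : ℕ => 1 / ((φ k : ℝ) + 1)) atTop (nhds 0) :=
      (tendsto_one_div_add_atTop_nhds_zero_nat (𝕜 := ℝ)).comp hφ.tendsto_atTop
    have h2 : Tendsto (fun k : ℕ => ((φ k : ℝ) + 1)) atTop atTop :=
      tendsto_atTop_add_const_right _ _
        ((tendsto_natCast_atTop_atTop (R := ℝ)).comp hφ.tendsto_atTop)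
    filter_upwards [h1.eventually_lt_const he, h2.eventually_ge_atTop T] with k hk hk2 s hs
    exact ((hτ (φ k) s ⟨hs.1, hs.2.trans hk2⟩).le.trans hk.le)
  -- uniform closeness of the trajectories
  have hunif : ∀ T > (0 : ℝ), ∀ ε > (0 : ℝ), ∀ᶠ k in atTop, ∀ s ∈ Set.Icc (0 : ℝ) T,
      ‖A (τ (φ k) + s) - W s B‖ ≤ ε := by
    intro T hT ε hε
    set η := ε / (8 * T) with hη
    have hη0 : 0 < η := by positivity
    set Q := R + M / (4 * η) * R ^ 2 + 1 with hQ
    have hQ0 : 0 < Q := by positivity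
    set e := ε / (8 * T * Q) with he
    have he0 : 0 < e := by positivity
    have hlim : Tendsto (fun k => M / (8 * η) * (f (τ (φ k)) - c)) atTop (nhds 0) := by
      simpa using (hfτ.sub_const c).const_mul (M / (8 * η))
    filter_upwards [hgen T e he0, hlim.eventually_lt_const (show 0 < ε / 4 by positivity),
      (Metric.tendsto_nhds.1 hB) (ε / 4) (by positivity)] with k hk1 hk2 hk3 s hs
    set u := τ (φ k) with hu
    have hu0 : 0 ≤ u := hτ0 _
    have hAd : ∀ s, 0 ≤ s → HasDerivAt (fun s => A (u + s)) (L (u + s) (A (u + s))) s := by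
      intro s hs
      exact (hA (u + s) (add_nonneg hu0 hs)).comp_const_add u s
    have hfdu : ∀ s, 0 ≤ s → HasDerivAt (fun s => f (u + s))
        (2 * ⟪A (u + s), L (u + s) (A (u + s))⟫) s := by
      intro s hs
      exact (hfd (u + s) (add_nonneg hu0 hs)).comp_const_add u s
    have hyd : ∀ s, 0 ≤ s → HasDerivAt (fun s => Wi s (A (u + s)) - A u)
        (Wi s (L (u + s) (A (u + s)) - K s (A (u + s)))) s := by
      intro s hs
      exact (hWd _ _ s hs (hAd s hs)).sub_const _
    have hBd : ∀ s, 0 ≤ s → HasDerivAt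
        (fun s => s * (η + e * Q) - M / (8 * η) * (f (u + s) - f u))
        (η + e * Q - M / (8 * η) * (2 * ⟪A (u + s), L (u + s) (A (u + s))⟫)) s := by
      intro s hs
      have h1 : HasDerivAt (fun s : ℝ => s * (η + e * Q)) (η + e * Q) s := by
        simpa using (hasDerivAt_id s).mul_const (η + e * Q)
      exact h1.sub (((hfdu s hs).sub_const _).const_mul _)
    have hmain := image_norm_le_of_norm_deriv_right_le_deriv_boundary'
      (f := fun s => Wi s (A (u + s)) - A u)
      (f' := fun s => Wi s (L (u + s) (A (u + s)) - K s (A (u + s)))) (a := 0) (b := T)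
      (fun s hs => (hyd s hs.1).continuousAt.continuousWithinAt)
      (fun s hs => (hyd s hs.1).hasDerivWithinAt)
      (B := fun s => s * (η + e * Q) - M / (8 * η) * (f (u + s) - f u))
      (B' := fun s => η + e * Q - M / (8 * η) * (2 * ⟪A (u + s), L (u + s) (A (u + s))⟫))
      (by simp [hW0])
      (fun s hs => (hBd s hs.1).continuousAt.continuousWithinAt)
      (fun s hs => (hBd s hs.1).hasDerivWithinAt)
      (by
        intro s hs
        have hs0 : 0 ≤ s := hs.1
        rw [hWi s hs0]
        set a := A (u + s) with ha
        have haR : ‖a‖ ≤ R := hAR _ (add_nonneg hu0 hs0)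
        have e1 : L (u + s) a - K s a = (L (u + s) - L s) a - N s a := by
          rw [_root_.sub_apply, hLKN s]; abel
        have hd := hk1 s ⟨hs0, hs.2.le⟩
        have n1 : ‖(L (u + s) - L s) a‖ ≤ e * R :=
          ((L (u + s) - L s).le_of_opNorm_le hd a).trans (by gcongr)
        have n2 : |⟪a, (L (u + s) - L s) a⟫| ≤ e * R ^ 2 := by
          refine (abs_real_inner_le_norm _ _).trans ?_
          calc ‖a‖ * ‖(L (u + s) - L s) a‖ ≤ R * (e * R) := by gcongr
            _ = _ := by ring
        have n3 := hNb s hs0 a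
        have e2 : ⟪a, N s a⟫ = ⟪a, (L (u + s) - L s) a⟫ - ⟪a, L (u + s) a⟫ := by
          rw [_root_.sub_apply, inner_sub_right, hLN s hs0]; ring
        have n4 : ‖N s a‖ ≤ η + 1 / (4 * η) * ‖N s a‖ ^ 2 := by
          have : 0 ≤ 1 / (4 * η) * (‖N s a‖ - 2 * η) ^ 2 := by positivity
          have e3 : 1 / (4 * η) * (‖N s a‖ - 2 * η) ^ 2
              = η + 1 / (4 * η) * ‖N s a‖ ^ 2 - ‖N s a‖ := by
            field_simp; ring
          linarith
        have n5 : 1 / (4 * η) * ‖N s a‖ ^ 2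
            ≤ M / (4 * η) * (e * R ^ 2) - M / (8 * η) * (2 * ⟪a, L (u + s) a⟫) := by
          calc _ ≤ 1 / (4 * η) * (M * (e * R ^ 2 - ⟪a, L (u + s) a⟫)) := by
                gcongr
                refine n3.trans ?_
                gcongr
                rw [e2]
                linarith [le_abs_self ⟪a, (L (u + s) - L s) a⟫]
            _ = _ := by field_simp; ring
        rw [e1]
        have n6 := norm_sub_le ((L (u + s) - L s) a) (N s a)
        have e4 : e * Q = e * R + M / (4 * η) * (e * R ^ 2) + e := by rw [hQ]; ring
        linarith)
    have hm := hmain hs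
    have hs0 : 0 ≤ s := hs.1
    have e5 : A (u + s) - W s B = W s (Wi s (A (u + s)) - B) := by
      rw [map_sub, hWWi s hs0]
    rw [e5, hW s hs0]
    have e6 : Wi s (A (u + s)) - B = (Wi s (A (u + s)) - A u) + (A u - B) := by abel
    rw [e6]
    refine (norm_add_le _ _).trans ?_
    have h7 : ‖A u - B‖ < ε / 4 := by
      have := hk3
      rwa [dist_eq_norm] at this
    have h8 : s * (η + e * Q) ≤ ε / 4 := by
      calc s * (η + e * Q) ≤ T * (η + e * Q) := by
            gcongr; exact hs.2
        _ = ε / 4 := by rw [hη, he]; field_simp; ring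
    have h9 : M / (8 * η) * (f u - f (u + s)) ≤ M / (8 * η) * (f u - c) := by
      gcongr
      exact hfc _ (add_nonneg hu0 hs0)
    have h10 : M / (8 * η) * (f u - c) < ε / 4 := hk2
    have h11 : - (M / (8 * η) * (f (u + s) - f u)) = M / (8 * η) * (f u - f (u + s)) := by ring
    linarith
  -- the limit is annihilated
  have hzero : ∀ t, 0 ≤ t → N t (W t B) = 0 := by
    intro t ht
    by_contra hne
    have hκ : 0 < ⟪W t B, N t (W t B)⟫ := by
      have := hNb t ht (W t B)
      have h0 : 0 < ‖N t (W t B)‖ ^ 2 := by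
        have := norm_pos_iff.2 hne
        positivity
      by_contra hle
      push Not at hle
      nlinarith
    set κ := ⟪W t B, N t (W t B)⟫ with hκd
    -- continuity
    have hLcont : ContinuousOn L (Set.Ici 0) := by
      intro t0 ht0
      rw [Metric.continuousWithinAt_iff]
      intro ε hε
      obtain ⟨δ, hδ, h⟩ := hLc t0 ht0 ε hε
      refine ⟨δ, hδ, fun {x} hx hxd => ?_⟩
      rw [dist_eq_norm]
      exact h x hx hxd
    have hgc : ContinuousOn (fun s => ⟪W s B, L s (W s B)⟫) (Set.Ici 0) :=
      (hWc B).inner (𝕜 := ℝ) (hLcont.clm_apply (hWc B))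
    have hg := (Metric.continuousWithinAt_iff.1 (hgc t ht)) (κ / 2) (by positivity)
    obtain ⟨δ, hδ, hδg⟩ := hg
    set r := δ / 2 with hr
    have hr0 : 0 < r := by positivity
    have hglt : ∀ s ∈ Set.Icc t (t + r), ⟪W s B, L s (W s B)⟫ < - (κ / 2) := by
      intro s hs
      have := hδg (Set.mem_Ici.2 (ht.trans hs.1)) (by
        rw [Real.dist_eq, abs_of_nonneg (by linarith [hs.1])]; linarith [hs.2])
      rw [Real.dist_eq, hLN t ht (W t B)] at this
      have := (abs_lt.1 this).2
      linarith
    set ε' := κ / (16 * (M * R + 1)) with hε'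
    have hMR : 0 < M * R + 1 := by positivity
    have hε'0 : 0 < ε' := by positivity
    set e := κ / (16 * (R ^ 2 + 1)) with he
    have he0 : 0 < e := by positivity
    have hlim : Tendsto (fun k => (f (τ (φ k)) - c)) atTop (nhds 0) := by
      simpa using (hfτ.sub_const c)
    obtain ⟨k, hk1, hk2, hk3⟩ := ((hgen (t + r) e he0).and
      ((hunif (t + r) (by positivity) ε' hε'0).and
      (hlim.eventually_lt_const (show 0 < r * (κ / 4) by positivity)))).exists
    set u := τ (φ k) with hu
    have hu0 : 0 ≤ u := hτ0 _
    have hfdu : ∀ s, 0 ≤ s → HasDerivAt (fun s => f (u + s))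
        (2 * ⟪A (u + s), L (u + s) (A (u + s))⟫) s := by
      intro s hs
      exact (hfd (u + s) (add_nonneg hu0 hs)).comp_const_add u s
    obtain ⟨s, hs, hsd⟩ := exists_hasDerivAt_eq_slope (fun s => f (u + s))
      (fun s => 2 * ⟪A (u + s), L (u + s) (A (u + s))⟫) (show t < t + r by linarith)
      (fun s hs => (hfdu s (ht.trans hs.1)).continuousAt.continuousWithinAt)
      (fun s hs => hfdu s (ht.trans hs.1.le))
    have hs0 : 0 ≤ s := ht.trans hs.1.le
    have hsI : s ∈ Set.Icc 0 (t + r) := ⟨hs0, hs.2.le⟩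
    have h1 := hglt s ⟨hs.1.le, hs.2.le⟩
    have h2 := hk1 s hsI
    have h3 := hk2 s hsI
    have hsl : -(κ / 4) ≤ (f (u + (t + r)) - f (u + t)) / (t + r - t) := by
      rw [add_sub_cancel_left, le_div_iff₀ hr0]
      have a1 := hfc (u + (t + r)) (by positivity)
      have a2 : f (u + t) ≤ f u := hanti (Set.mem_Ici.2 hu0) (Set.mem_Ici.2 (by positivity))
        (by linarith)
      have a3 : f u - c < r * (κ / 4) := hk3
      nlinarith
    rw [← hsd] at hsl
    set a := A (u + s) with ha
    set b := W s B with hb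
    have haR : ‖a‖ ≤ R := hAR _ (add_nonneg hu0 hs0)
    have hbR : ‖b‖ ≤ R := by rw [hb, hW s hs0]; exact hBR
    have e1 : ⟪a, L (u + s) a⟫ - ⟪b, L s b⟫
        = ⟪a, (L (u + s) - L s) a⟫ + ⟪a, L s (a - b)⟫ + ⟪a - b, L s b⟫ := by
      simp only [_root_.sub_apply, map_sub, inner_sub_left, inner_sub_right]
      ring
    have n1 : |⟪a, (L (u + s) - L s) a⟫| ≤ e * R ^ 2 := by
      refine (abs_real_inner_le_norm _ _).trans ?_
      calc ‖a‖ * ‖(L (u + s) - L s) a‖ ≤ R * (e * R) := by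
            gcongr
            exact ((L (u + s) - L s).le_of_opNorm_le h2 a).trans (by gcongr)
        _ = _ := by ring
    have n2 : |⟪a, L s (a - b)⟫| ≤ ε' * (M * R) := by
      refine (abs_real_inner_le_norm _ _).trans ?_
      calc ‖a‖ * ‖L s (a - b)‖ ≤ R * (M * ε') := by
            gcongr
            exact ((L s).le_of_opNorm_le (hLM s hs0) _).trans (by gcongr)
        _ = _ := by ring
    have n3 : |⟪a - b, L s b⟫| ≤ ε' * (M * R) := by
      refine (abs_real_inner_le_norm _ _).trans ?_
      have n4 : ‖L s b‖ ≤ M * R := ((L s).le_of_opNorm_le (hLM s hs0) _).trans (by gcongr)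
      gcongr
    have m1 : e * R ^ 2 ≤ κ / 16 := by
      have : e * (R ^ 2 + 1) = κ / 16 := by rw [he]; field_simp
      nlinarith
    have m2 : ε' * (M * R) ≤ κ / 16 := by
      have : ε' * (M * R + 1) = κ / 16 := by rw [hε']; field_simp
      nlinarith
    have l1 := (abs_le.1 n1).2
    have l2 := (abs_le.1 n2).2
    have l3 := (abs_le.1 n3).2
    linarith
  have hB0 : B = 0 := hV B hBV hzero
  rw [hB0, norm_zero, zero_pow two_ne_zero] at hBc
  rw [← hBc] at hc
  have := hc.sqrt
  rw [Real.sqrt_zero] at this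
  refine tendsto_zero_iff_norm_tendsto_zero.2 (this.congr fun t => ?_)
  rw [hf]
  exact Real.sqrt_sq (norm_nonneg _)

end Abstract

section MatrixPart
variable {d : ℕ}

/-- The identification of matrices with a Euclidean space (Hilbert–Schmidt structure). -/
noncomputable def hsJ (d : ℕ) :
    Matrix (Fin d) (Fin d) ℂ ≃ₗ[ℝ] EuclideanSpace ℂ (Fin d × Fin d) where
  toFun A := WithLp.toLp 2 (fun p => A p.1 p.2)
  invFun x := Matrix.of (fun i j => x (i, j))
  map_add' A B := by ext p; simp
  map_smul' c A := by ext p; simp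
  left_inv A := by ext i j; simp
  right_inv x := by ext p; simp

theorem hsJ_inner (A B : Matrix (Fin d) (Fin d) ℂ) :
    inner ℝ (hsJ d A) (hsJ d B) = (Matrix.trace (Aᴴ * B)).re := by
  simp only [hsJ, LinearEquiv.coe_mk, LinearMap.coe_mk, AddHom.coe_mk, PiLp.inner_apply,
    Matrix.trace, Matrix.diag, Matrix.mul_apply, Matrix.conjTranspose_apply]
  rw [Fintype.sum_prod_type, Finset.sum_comm]
  simp [Complex.inner, mul_comm]

theorem hsJ_norm (A : Matrix (Fin d) (Fin d) ℂ) : ‖hsJ d A‖ = hsNorm A := by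
  rw [hsNorm, ← hsJ_inner, real_inner_self_eq_norm_sq, Real.sqrt_sq (norm_nonneg _)]

theorem hsJ_cont : Continuous (hsJ d) :=
  LinearMap.continuous_of_finiteDimensional (hsJ d).toLinearMap

theorem hsJ_symm_cont : Continuous (hsJ d).symm :=
  LinearMap.continuous_of_finiteDimensional (hsJ d).symm.toLinearMap

theorem hsJ_deriv {y : ℝ → Matrix (Fin d) (Fin d) ℂ} {y' : Matrix (Fin d) (Fin d) ℂ} {t : ℝ}
    (h : HasDerivAt y y' t) : HasDerivAt (fun s => hsJ d (y s)) (hsJ d y') t :=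
  (LinearMap.toContinuousLinearMap (hsJ d).toLinearMap).hasFDerivAt.comp_hasDerivAt t h

theorem hsJ_symm_deriv {y : ℝ → EuclideanSpace ℂ (Fin d × Fin d)}
    {y' : EuclideanSpace ℂ (Fin d × Fin d)} {t : ℝ}
    (h : HasDerivAt y y' t) : HasDerivAt (fun s => (hsJ d).symm (y s)) ((hsJ d).symm y') t :=
  (LinearMap.toContinuousLinearMap (hsJ d).symm.toLinearMap).hasFDerivAt.comp_hasDerivAt t h

/-- A superoperator, transported to Euclidean space. -/
noncomputable def hsS (Φ : Matrix (Fin d) (Fin d) ℂ →ₗ[ℝ] Matrix (Fin d) (Fin d) ℂ) :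
    EuclideanSpace ℂ (Fin d × Fin d) →L[ℝ] EuclideanSpace ℂ (Fin d × Fin d) :=
  LinearMap.toContinuousLinearMap
    ((hsJ d).toLinearMap ∘ₗ Φ ∘ₗ (hsJ d).symm.toLinearMap)

theorem hsS_apply (Φ : Matrix (Fin d) (Fin d) ℂ →ₗ[ℝ] Matrix (Fin d) (Fin d) ℂ)
    (x : EuclideanSpace ℂ (Fin d × Fin d)) : hsS Φ x = hsJ d (Φ ((hsJ d).symm x)) := rfl

theorem hsS_norm_le (Φ : Matrix (Fin d) (Fin d) ℂ →ₗ[ℝ] Matrix (Fin d) (Fin d) ℂ) :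
    ‖hsS Φ‖ ≤ opNorm2 (fun A => Φ A) := by
  have hbdd : BddAbove {r : ℝ | ∃ A, hsNorm A = 1 ∧ r = hsNorm (Φ A)} := by
    refine ⟨‖hsS Φ‖, ?_⟩
    rintro r ⟨A, hA, rfl⟩
    have := (hsS Φ).le_opNorm (hsJ d A)
    rw [hsS_apply, LinearEquiv.symm_apply_apply, hsJ_norm, hsJ_norm, hA, mul_one] at this
    exact this
  have hnn : 0 ≤ opNorm2 (fun A => Φ A) := by
    refine Real.sSup_nonneg ?_
    rintro r ⟨A, hA, rfl⟩
    exact Real.sqrt_nonneg _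
  refine ContinuousLinearMap.opNorm_le_bound _ hnn (fun x => ?_)
  by_cases hx : x = 0
  · simp [hx]
  have hx0 : ‖x‖ ≠ 0 := norm_ne_zero_iff.2 hx
  have hx1 : ‖(‖x‖⁻¹ : ℝ) • x‖ = 1 := by
    rw [norm_smul, norm_inv, norm_norm, inv_mul_cancel₀ hx0]
  have h1 : ‖hsS Φ ((‖x‖⁻¹ : ℝ) • x)‖ ≤ opNorm2 (fun A => Φ A) := by
    refine le_csSup hbdd ⟨(hsJ d).symm ((‖x‖⁻¹ : ℝ) • x), ?_, ?_⟩
    · rw [← hsJ_norm, LinearEquiv.apply_symm_apply, hx1]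
    · rw [hsS_apply, hsJ_norm]
  rw [map_smul, norm_smul, norm_inv, norm_norm, inv_mul_le_iff₀ (by positivity)] at h1
  linarith

theorem mat_mul_deriv {x y : ℝ → Matrix (Fin d) (Fin d) ℂ} {x' y' : Matrix (Fin d) (Fin d) ℂ}
    {t : ℝ} (hx : HasDerivAt x x' t) (hy : HasDerivAt y y' t) :
    HasDerivAt (fun s => x s * y s) (x t * y' + x' * y t) t :=
  ((LinearMap.mul ℝ (Matrix (Fin d) (Fin d) ℂ)).toContinuousBilinearMap).hasDerivAt_of_bilinear
    (fun _ => hx) (fun _ => hy)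

theorem mat_star_deriv {x : ℝ → Matrix (Fin d) (Fin d) ℂ} {x' : Matrix (Fin d) (Fin d) ℂ}
    {t : ℝ} (hx : HasDerivAt x x' t) : HasDerivAt (fun s => (x s)ᴴ) (x'ᴴ) t := by
  have := (LinearMap.toContinuousLinearMap
    ((Matrix.conjTransposeLinearEquiv (Fin d) (Fin d) ℝ ℂ).toLinearMap)).hasFDerivAt.comp_hasDerivAt t hx
  exact this

/-- Hamiltonian part as a linear map. -/
noncomputable def opK (P : Matrix (Fin d) (Fin d) ℂ) :
    Matrix (Fin d) (Fin d) ℂ →ₗ[ℝ] Matrix (Fin d) (Fin d) ℂ where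
  toFun X := (-Complex.I) • (P * X - X * P)
  map_add' X Y := by rw [← smul_add]; congr 1; noncomm_ring
  map_smul' c X := by
    simp only [Matrix.mul_smul, Matrix.smul_mul, ← smul_sub, RingHom.id_apply]
    rw [smul_comm]

/-- Minus the dissipative part, as a linear map. -/
noncomputable def opN {M : ℕ} (Q : Fin M → Matrix (Fin d) (Fin d) ℂ) :
    Matrix (Fin d) (Fin d) ℂ →ₗ[ℝ] Matrix (Fin d) (Fin d) ℂ where
  toFun X := - ∑ m : Fin M, (Q m * X * Q m - (2⁻¹ : ℂ) • ((Q m) ^ 2 * X + X * (Q m) ^ 2))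
  map_add' X Y := by
    rw [← neg_add, ← Finset.sum_add_distrib]
    congr 1
    refine Finset.sum_congr rfl fun m _ => ?_
    simp only [mul_add, add_mul, smul_add]
    abel
  map_smul' c X := by
    rw [RingHom.id_apply, smul_neg, Finset.smul_sum]
    congr 1
    refine Finset.sum_congr rfl fun m _ => ?_
    simp only [Matrix.mul_smul, Matrix.smul_mul, smul_sub, ← smul_add]
    rw [smul_comm c (2⁻¹ : ℂ)]

/-- Conjugation `X ↦ P X Pᴴ`. -/
noncomputable def opW (P : Matrix (Fin d) (Fin d) ℂ) :
    Matrix (Fin d) (Fin d) ℂ →ₗ[ℝ] Matrix (Fin d) (Fin d) ℂ where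
  toFun X := P * X * Pᴴ
  map_add' X Y := by noncomm_ring
  map_smul' c X := by simp

theorem gksl_eq {M : ℕ} (H : ℝ → Matrix (Fin d) (Fin d) ℂ)
    (L : Fin M → ℝ → Matrix (Fin d) (Fin d) ℂ) (t : ℝ) (X : Matrix (Fin d) (Fin d) ℂ) :
    gksl H L t X = (opK (H t) - opN (fun m => L m t)) X := by
  simp only [gksl, opK, opN, LinearMap.sub_apply, LinearMap.coe_mk, AddHom.coe_mk, sub_neg_eq_add]

theorem opK_inner (P : Matrix (Fin d) (Fin d) ℂ) (hP : P.IsHermitian)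
    (X : Matrix (Fin d) (Fin d) ℂ) : (Matrix.trace (Xᴴ * opK P X)).re = 0 := by
  have h1 : star (Matrix.trace (Xᴴ * (P * X))) = Matrix.trace (Xᴴ * (P * X)) := by
    rw [← Matrix.trace_conjTranspose]
    simp [Matrix.conjTranspose_mul, hP.eq, Matrix.mul_assoc]
  have h2 : star (Matrix.trace (Xᴴ * (X * P))) = Matrix.trace (Xᴴ * (X * P)) := by
    rw [← Matrix.trace_conjTranspose]
    simp only [Matrix.conjTranspose_mul, hP.eq, Matrix.conjTranspose_conjTranspose]
    rw [Matrix.mul_assoc, Matrix.trace_mul_comm, Matrix.mul_assoc]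
  have h1' := Complex.conj_eq_iff_im.1 h1
  have h2' := Complex.conj_eq_iff_im.1 h2
  simp [opK, Matrix.mul_sub, Matrix.trace_sub, h1', h2']

theorem opN_inner {M : ℕ} (Q : Fin M → Matrix (Fin d) (Fin d) ℂ) (hQ : ∀ m, (Q m).IsHermitian)
    (X Y : Matrix (Fin d) (Fin d) ℂ) : Matrix.trace (Xᴴ * opN Q Y) =
      (2⁻¹ : ℂ) * ∑ m, Matrix.trace ((Q m * X - X * Q m)ᴴ * (Q m * Y - Y * Q m)) := by
  simp only [opN, LinearMap.coe_mk, AddHom.coe_mk]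
  rw [← Finset.sum_neg_distrib, Matrix.mul_sum, Matrix.trace_sum, Finset.mul_sum]
  refine Finset.sum_congr rfl fun m _ => ?_
  have hm := (hQ m).eq
  generalize Q m = P at hm
  rw [Matrix.conjTranspose_sub, Matrix.conjTranspose_mul, Matrix.conjTranspose_mul, hm]
  have e1 : Matrix.trace (P * Xᴴ * (P * Y)) = Matrix.trace (Xᴴ * (P * Y * P)) := by
    rw [Matrix.mul_assoc, Matrix.trace_mul_comm, Matrix.mul_assoc]
  have e2 : Matrix.trace (P * Xᴴ * (Y * P)) = Matrix.trace (Xᴴ * (Y * P ^ 2)) := by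
    rw [Matrix.mul_assoc, Matrix.trace_mul_comm]
    simp only [pow_two, Matrix.mul_assoc]
  have e3 : Matrix.trace (Xᴴ * P * (P * Y)) = Matrix.trace (Xᴴ * (P ^ 2 * Y)) := by
    simp only [pow_two, Matrix.mul_assoc]
  have e4 : Matrix.trace (Xᴴ * P * (Y * P)) = Matrix.trace (Xᴴ * (P * Y * P)) := by
    simp only [Matrix.mul_assoc]
  simp only [Matrix.mul_sub, Matrix.sub_mul, Matrix.trace_sub, Matrix.mul_neg, Matrix.trace_neg,
    Matrix.mul_smul, Matrix.trace_smul, Matrix.mul_add, Matrix.trace_add, e1, e2, e3, e4,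
    smul_eq_mul]
  ring

theorem hs_nonneg (X : Matrix (Fin d) (Fin d) ℂ) : 0 ≤ (Matrix.trace (Xᴴ * X)).re := by
  rw [← hsJ_inner]; exact real_inner_self_nonneg

theorem hs_zero (X : Matrix (Fin d) (Fin d) ℂ) (h : (Matrix.trace (Xᴴ * X)).re = 0) : X = 0 := by
  rw [← hsJ_inner, inner_self_eq_zero] at h
  simpa using h

theorem opN_inner_re {M : ℕ} (Q : Fin M → Matrix (Fin d) (Fin d) ℂ)
    (hQ : ∀ m, (Q m).IsHermitian)
    (X Y : Matrix (Fin d) (Fin d) ℂ) : (Matrix.trace (Xᴴ * opN Q Y)).re =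
      (2⁻¹ : ℝ) * ∑ m, (Matrix.trace ((Q m * X - X * Q m)ᴴ * (Q m * Y - Y * Q m))).re := by
  rw [opN_inner Q hQ, ← Complex.re_sum]
  have : (2⁻¹ : ℂ) = ((2⁻¹ : ℝ) : ℂ) := by push_cast; rfl
  rw [this, Complex.re_ofReal_mul]

theorem opN_zero_comm {M : ℕ} (Q : Fin M → Matrix (Fin d) (Fin d) ℂ)
    (hQ : ∀ m, (Q m).IsHermitian) (X : Matrix (Fin d) (Fin d) ℂ)
    (h : (Matrix.trace (Xᴴ * opN Q X)).re = 0) (m : Fin M) : Commute (Q m) X := by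
  rw [opN_inner_re Q hQ] at h
  have h1 : ∑ m, (Matrix.trace ((Q m * X - X * Q m)ᴴ * (Q m * X - X * Q m))).re = 0 := by
    linarith
  rw [Finset.sum_eq_zero_iff_of_nonneg (fun m _ => hs_nonneg _)] at h1
  exact sub_eq_zero.1 (hs_zero _ (h1 m (Finset.mem_univ m)))

theorem opN_of_comm {M : ℕ} (Q : Fin M → Matrix (Fin d) (Fin d) ℂ)
    (X : Matrix (Fin d) (Fin d) ℂ) (h : ∀ m, Commute (Q m) X) : opN Q X = 0 := by
  simp only [opN, LinearMap.coe_mk, AddHom.coe_mk, neg_eq_zero]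
  refine Finset.sum_eq_zero fun m _ => ?_
  have h1 := (h m).eq
  have e1 : Q m ^ 2 * X = Q m * X * Q m := by
    rw [pow_two, Matrix.mul_assoc, h1, ← Matrix.mul_assoc, h1]
  have e2 : X * Q m ^ 2 = Q m * X * Q m := by
    rw [pow_two, ← Matrix.mul_assoc, ← h1]
  rw [e1, e2, ← two_smul ℂ, smul_smul]
  norm_num

theorem opK_of_comm (P : Matrix (Fin d) (Fin d) ℂ)
    (X : Matrix (Fin d) (Fin d) ℂ) : opK P X = 0 ↔ Commute P X := by
  simp only [opK, LinearMap.coe_mk, AddHom.coe_mk, smul_eq_zero, neg_eq_zero, Complex.I_ne_zero,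
    false_or, sub_eq_zero]
  rfl

theorem opW_norm (P X : Matrix (Fin d) (Fin d) ℂ) (hP : Pᴴ * P = 1) :
    ‖hsJ d (opW P X)‖ = ‖hsJ d X‖ := by
  rw [hsJ_norm, hsJ_norm, hsNorm, hsNorm]
  congr 2
  simp only [opW, LinearMap.coe_mk, AddHom.coe_mk, Matrix.conjTranspose_mul,
    Matrix.conjTranspose_conjTranspose]
  rw [Matrix.trace_mul_comm]
  have : P * X * Pᴴ * (P * (Xᴴ * Pᴴ)) = P * (X * (Pᴴ * P) * Xᴴ * Pᴴ) := by
    simp only [Matrix.mul_assoc]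
  rw [this, hP, Matrix.trace_mul_comm, Matrix.mul_one]
  have : X * Xᴴ * Pᴴ * P = X * Xᴴ * (Pᴴ * P) := by
    simp only [Matrix.mul_assoc]
  rw [this, hP, Matrix.mul_one, Matrix.trace_mul_comm]

theorem unitary_of_deriv (H U : ℝ → Matrix (Fin d) (Fin d) ℂ)
    (hH : ∀ t : ℝ, 0 ≤ t → (H t).IsHermitian) (hU0 : U 0 = 1)
    (hU : ∀ t : ℝ, 0 ≤ t → HasDerivAt U ((-Complex.I) • (H t * U t)) t)
    (O : Matrix (Fin d) (Fin d) ℂ) (hO : ∀ t : ℝ, 0 ≤ t → Commute (H t) O)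
    (t : ℝ) (ht : 0 ≤ t) : (U t)ᴴ * O * U t = O := by
  have hd : ∀ s, 0 ≤ s → HasDerivAt (fun s => (U s)ᴴ * O * U s) 0 s := by
    intro s hs
    have h1 := mat_mul_deriv (mat_mul_deriv (mat_star_deriv (hU s hs)) (hasDerivAt_const s O))
      (hU s hs)
    refine h1.congr_deriv ?_
    have e : H s * O = O * H s := (hO s hs).eq
    simp only [Matrix.conjTranspose_smul, Matrix.conjTranspose_mul, (hH s hs).eq,
      Matrix.mul_zero, zero_add, Matrix.mul_smul, Matrix.smul_mul]
    have e2 : (U s)ᴴ * H s * O * U s = (U s)ᴴ * O * (H s * U s) := by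
      rw [Matrix.mul_assoc (U s)ᴴ, e]; simp only [Matrix.mul_assoc]
    rw [e2, ← add_smul]
    simp
  have := constant_of_has_deriv_right_zero (f := fun s => (U s)ᴴ * O * U s) (a := 0) (b := t)
    (fun s hs => (hd s hs.1).continuousAt.continuousWithinAt)
    (fun s hs => (hd s hs.1).hasDerivWithinAt) t ⟨ht, le_rfl⟩
  simpa [hU0] using this

theorem density_closed {ρs : ℝ → Matrix (Fin d) (Fin d) ℂ} {σ : Matrix (Fin d) (Fin d) ℂ}
    (h : ∀ t, 0 ≤ t → IsDensity (ρs t)) (hσ : Tendsto ρs atTop (nhds σ)) : IsDensity σ := by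
  have hev : ∀ᶠ t in atTop, IsDensity (ρs t) := by
    filter_upwards [eventually_ge_atTop 0] with t ht using h t ht
  constructor
  · rw [Matrix.posSemidef_iff_dotProduct_mulVec]
    constructor
    · have h1 : Tendsto (fun t => (ρs t)ᴴ) atTop (nhds σᴴ) :=
        (Continuous.tendsto (by fun_prop) σ).comp hσ
      refine tendsto_nhds_unique h1 (hσ.congr' ?_)
      filter_upwards [hev] with t ht
      exact ht.1.isHermitian.eq.symm
    · intro x
      have h1 : Tendsto (fun t => star x ⬝ᵥ (ρs t *ᵥ x)) atTop (nhds (star x ⬝ᵥ (σ *ᵥ x))) :=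
        (Continuous.tendsto (f := fun A : Matrix (Fin d) (Fin d) ℂ => star x ⬝ᵥ (A *ᵥ x))
          (by fun_prop) σ).comp hσ
      refine ge_of_tendsto h1 ?_
      filter_upwards [hev] with t ht
      exact ht.1.dotProduct_mulVec_nonneg x
  · have h1 : Tendsto (fun t => Matrix.trace (ρs t)) atTop (nhds (Matrix.trace σ)) :=
      (Continuous.tendsto (f := fun A : Matrix (Fin d) (Fin d) ℂ => Matrix.trace A)
        (by fun_prop) σ).comp hσ
    refine tendsto_nhds_unique h1 (tendsto_const_nhds.congr' ?_)
    filter_upwards [hev] with t ht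
    exact ht.2.symm

end MatrixPart

section Main
variable {d M : ℕ}

/-- The consequences of `CondQ` for the transported generator. -/
theorem condQ_transport (H : ℝ → Matrix (Fin d) (Fin d) ℂ)
    (L : Fin M → ℝ → Matrix (Fin d) (Fin d) ℂ) (hQ : CondQ (gksl H L)) :
    ∃ G : ℝ → EuclideanSpace ℂ (Fin d × Fin d) →L[ℝ] EuclideanSpace ℂ (Fin d × Fin d),
    (∀ t, G t = hsS (opK (H t)) - hsS (opN (fun m => L m t))) ∧
    (∀ t X, G t (hsJ d X) = hsJ d (gksl H L t X)) ∧
    ∃ B > (0 : ℝ), (∀ t, 0 ≤ t → ‖G t‖ ≤ B) ∧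
    (∀ t0 : ℝ, 0 ≤ t0 → ∀ ε > (0 : ℝ), ∃ δ > (0 : ℝ), ∀ t : ℝ, 0 ≤ t → |t - t0| < δ →
      ‖G t - G t0‖ < ε) ∧
    (∀ ε > (0 : ℝ), ∀ δ > (0 : ℝ), ∀ t0 : ℝ, 0 ≤ t0 → ∀ T : ℝ,
      ∃ τ : ℝ, T ≤ τ ∧ 0 ≤ τ ∧ ∀ t ∈ Set.Icc (0 : ℝ) δ, ‖G (τ + t) - G (t0 + t)‖ < ε) := by
  obtain ⟨hc, ⟨B, hB, hb⟩, hrec⟩ := hQ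
  set Φ : ℝ → Matrix (Fin d) (Fin d) ℂ →ₗ[ℝ] Matrix (Fin d) (Fin d) ℂ :=
    fun t => opK (H t) - opN (fun m => L m t) with hΦ
  have hΦe : ∀ t X, gksl H L t X = Φ t X := fun t X => gksl_eq H L t X
  have hsub : ∀ s t, ‖hsS (Φ s) - hsS (Φ t)‖ ≤ opNorm2 (fun A => gksl H L s A - gksl H L t A) := by
    intro s t
    have e : hsS (Φ s) - hsS (Φ t) = hsS (Φ s - Φ t) := by
      ext1 x
      simp [hsS_apply]
    rw [e]
    refine (hsS_norm_le _).trans (le_of_eq ?_)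
    congr 1
    funext A
    rw [hΦe, hΦe, LinearMap.sub_apply]
  refine ⟨fun t => hsS (Φ t), ?_, ?_, B, hB, ?_, ?_, ?_⟩
  · intro t
    ext1 x
    simp [hsS_apply, hΦ]
  · intro t X
    rw [hsS_apply, LinearEquiv.symm_apply_apply, hΦe]
  · intro t ht
    refine (hsS_norm_le _).trans (le_trans (le_of_eq ?_) (hb t ht))
    congr 1
    funext A
    rw [hΦe]
  · intro t0 ht0 ε hε
    obtain ⟨δ, hδ, h⟩ := hc t0 ht0 ε hε
    exact ⟨δ, hδ, fun t ht htd => (hsub _ _).trans_lt (h t ht htd)⟩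
  · intro ε hε δ hδ t0 ht0 T
    obtain ⟨ts, h0, hgap, hts⟩ := hrec ε hε δ hδ t0 ht0
    have hgrow : ∀ n : ℕ, (n : ℝ) * δ ≤ ts n := by
      intro n
      induction n with
      | zero => simpa using h0 0
      | succ k ih =>
        have := hgap k
        push_cast
        linarith
    obtain ⟨n, hn⟩ := exists_nat_ge (T / δ)
    refine ⟨ts n, ?_, h0 n, fun t ht => (hsub _ _).trans_lt (hts n t ht)⟩
    have : T ≤ n * δ := by rwa [div_le_iff₀ hδ] at hn
    exact this.trans (hgrow n)

theorem opW_deriv (H U : ℝ → Matrix (Fin d) (Fin d) ℂ)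
    (hH : ∀ t : ℝ, 0 ≤ t → (H t).IsHermitian)
    (hU : ∀ t : ℝ, 0 ≤ t → HasDerivAt U ((-Complex.I) • (H t * U t)) t)
    (y : ℝ → Matrix (Fin d) (Fin d) ℂ) (y' : Matrix (Fin d) (Fin d) ℂ) (t : ℝ) (ht : 0 ≤ t)
    (hy : HasDerivAt y y' t) :
    HasDerivAt (fun s => opW ((U s)ᴴ) (y s)) (opW ((U t)ᴴ) (y' - opK (H t) (y t))) t := by
  have h1 := mat_mul_deriv (mat_mul_deriv (mat_star_deriv (hU t ht)) hy) (hU t ht)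
  simp only [opW, opK, LinearMap.coe_mk, AddHom.coe_mk, Matrix.conjTranspose_conjTranspose]
  refine h1.congr_deriv ?_
  simp only [Matrix.conjTranspose_smul, Matrix.conjTranspose_mul, (hH t ht).eq,
    Matrix.mul_smul, Matrix.smul_mul, Matrix.mul_sub, Matrix.sub_mul, Matrix.mul_add,
    Matrix.add_mul, smul_sub, Matrix.mul_assoc, neg_smul, star_neg, Complex.star_def,
    Complex.conj_I, neg_neg, Matrix.mul_neg, Matrix.neg_mul, Matrix.conjTranspose_neg,
    sub_neg_eq_add]
  abel

theorem opW_deriv2 (H U : ℝ → Matrix (Fin d) (Fin d) ℂ)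
    (hH : ∀ t : ℝ, 0 ≤ t → (H t).IsHermitian)
    (hU : ∀ t : ℝ, 0 ≤ t → HasDerivAt U ((-Complex.I) • (H t * U t)) t)
    (X : Matrix (Fin d) (Fin d) ℂ) (t : ℝ) (ht : 0 ≤ t) :
    HasDerivAt (fun s => opW (U s) X) (opK (H t) (opW (U t) X)) t := by
  have h1 := mat_mul_deriv (mat_mul_deriv (hU t ht) (hasDerivAt_const t X))
    (mat_star_deriv (hU t ht))
  simp only [opW, opK, LinearMap.coe_mk, AddHom.coe_mk]
  refine h1.congr_deriv ?_
  simp only [Matrix.conjTranspose_smul, Matrix.conjTranspose_mul, (hH t ht).eq,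
    Matrix.mul_smul, Matrix.smul_mul, Matrix.mul_zero, zero_add,
    smul_sub, Matrix.mul_assoc, neg_smul, star_neg, Complex.star_def,
    Complex.conj_I, neg_neg, Matrix.mul_neg, Matrix.neg_mul, Matrix.conjTranspose_neg,
    sub_neg_eq_add]
  abel

/-- The interaction-picture commutant as a real subspace. -/
noncomputable def cInt (U : ℝ → Matrix (Fin d) (Fin d) ℂ)
    (L : Fin M → ℝ → Matrix (Fin d) (Fin d) ℂ) :
    Submodule ℝ (EuclideanSpace ℂ (Fin d × Fin d)) where
  carrier := {x | ∀ m, ∀ t : ℝ, 0 ≤ t → Commute ((U t)ᴴ * L m t * U t) ((hsJ d).symm x)}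
  add_mem' := by
    intro a b ha hb m t ht
    rw [map_add]
    exact (ha m t ht).add_right (hb m t ht)
  zero_mem' := by
    intro m t ht
    rw [map_zero]
    exact Commute.zero_right _
  smul_mem' := by
    intro c x hx m t ht
    rw [map_smul]
    exact (hx m t ht).smul_right c

theorem comm_iff (U P X : Matrix (Fin d) (Fin d) ℂ) (h1 : Uᴴ * U = 1) (h2 : U * Uᴴ = 1) :
    Commute (Uᴴ * P * U) X ↔ Commute P (opW U X) := by
  simp only [opW, LinearMap.coe_mk, AddHom.coe_mk, Commute, SemiconjBy]
  constructor
  · intro h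
    calc P * (U * X * Uᴴ) = U * (Uᴴ * P * U * X) * Uᴴ := by
          have : U * (Uᴴ * P * U * X) * Uᴴ = (U * Uᴴ) * P * U * X * Uᴴ := by
            simp only [Matrix.mul_assoc]
          rw [this, h2]; simp only [Matrix.mul_assoc, Matrix.one_mul]
      _ = U * (X * (Uᴴ * P * U)) * Uᴴ := by rw [h]
      _ = U * X * Uᴴ * P := by
          have : U * (X * (Uᴴ * P * U)) * Uᴴ = U * X * Uᴴ * P * (U * Uᴴ) := by
            simp only [Matrix.mul_assoc]
          rw [this, h2, Matrix.mul_one]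
  · intro h
    calc Uᴴ * P * U * X = Uᴴ * (P * (U * X * Uᴴ)) * U := by
          have : Uᴴ * (P * (U * X * Uᴴ)) * U = Uᴴ * P * U * X * (Uᴴ * U) := by
            simp only [Matrix.mul_assoc]
          rw [this, h1, Matrix.mul_one]
      _ = Uᴴ * (U * X * Uᴴ * P) * U := by rw [h]
      _ = X * (Uᴴ * P * U) := by
          have : Uᴴ * (U * X * Uᴴ * P) * U = (Uᴴ * U) * X * (Uᴴ * P * U) := by
            simp only [Matrix.mul_assoc]
          rw [this, h1, Matrix.one_mul]

/-- Every solution converges if the interaction commutant lies in the Schrödinger commutant. -/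
theorem solution_converges
    (H : ℝ → Matrix (Fin d) (Fin d) ℂ)
    (L : Fin M → ℝ → Matrix (Fin d) (Fin d) ℂ)
    (hH : ∀ t : ℝ, 0 ≤ t → (H t).IsHermitian)
    (hL : ∀ m, ∀ t : ℝ, 0 ≤ t → (L m t).IsHermitian)
    (hQ : CondQ (gksl H L))
    (U : ℝ → Matrix (Fin d) (Fin d) ℂ)
    (hU0 : U 0 = 1)
    (hU : ∀ t : ℝ, 0 ≤ t → HasDerivAt U ((-Complex.I) • (H t * U t)) t)
    (hC : ∀ O : Matrix (Fin d) (Fin d) ℂ,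
        (∀ m, ∀ t : ℝ, 0 ≤ t → Commute ((U t)ᴴ * L m t * U t) O) →
        ((∀ t : ℝ, 0 ≤ t → Commute (H t) O) ∧
            ∀ m, ∀ t : ℝ, 0 ≤ t → Commute (L m t) O))
    (ρ : ℝ → Matrix (Fin d) (Fin d) ℂ)
    (hρ : ∀ t : ℝ, 0 ≤ t → HasDerivAt ρ (gksl H L t (ρ t)) t) :
    ∃ σ, Tendsto ρ atTop (nhds σ) := by
  obtain ⟨G, hG, hGJ, B, hB, hGB, hGc, hGrec⟩ := condQ_transport H L hQ
  have hUU : ∀ t, 0 ≤ t → (U t)ᴴ * U t = 1 := by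
    intro t ht
    simpa using unitary_of_deriv H U hH hU0 hU 1 (fun s _ => Commute.one_right _) t ht
  have hUU' : ∀ t, 0 ≤ t → U t * (U t)ᴴ = 1 := fun t ht => mul_eq_one_comm.1 (hUU t ht)
  have hK : ∀ t, 0 ≤ t → ∀ x, inner ℝ x (hsS (opK (H t)) x) = 0 := by
    intro t ht x
    obtain ⟨X, rfl⟩ := (hsJ d).surjective x
    rw [hsS_apply, LinearEquiv.symm_apply_apply, hsJ_inner]
    exact opK_inner _ (hH t ht) X
  have hNi : ∀ t, 0 ≤ t → ∀ X Y, inner ℝ (hsJ d X) (hsS (opN (fun m => L m t)) (hsJ d Y)) =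
      (2⁻¹ : ℝ) * ∑ m, inner ℝ (hsJ d (L m t * X - X * L m t)) (hsJ d (L m t * Y - Y * L m t)) := by
    intro t ht X Y
    rw [hsS_apply, LinearEquiv.symm_apply_apply, hsJ_inner,
      opN_inner_re _ (fun m => hL m t ht)]
    simp only [hsJ_inner]
  have hsym : ∀ t, 0 ≤ t → ∀ x y, inner ℝ (hsS (opN (fun m => L m t)) x) y
      = inner ℝ x (hsS (opN (fun m => L m t)) y) := by
    intro t ht x y
    obtain ⟨X, rfl⟩ := (hsJ d).surjective x
    obtain ⟨Y, rfl⟩ := (hsJ d).surjective y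
    rw [real_inner_comm, hNi t ht, hNi t ht]
    congr 1
    exact Finset.sum_congr rfl fun m _ => real_inner_comm _ _
  have hpos : ∀ t, 0 ≤ t → ∀ x, 0 ≤ inner ℝ x (hsS (opN (fun m => L m t)) x) := by
    intro t ht x
    obtain ⟨X, rfl⟩ := (hsJ d).surjective x
    rw [hNi t ht]
    exact mul_nonneg (by norm_num) (Finset.sum_nonneg fun m _ => real_inner_self_nonneg)
  have hGi : ∀ t, 0 ≤ t → ∀ O, Commute (H t) O → (∀ m, Commute (L m t) O) → ∀ x,
      inner ℝ (hsJ d O) (G t x) = 0 := by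
    intro t ht O h1 h2 x
    have hKO : hsS (opK (H t)) (hsJ d O) = 0 := by
      rw [hsS_apply, LinearEquiv.symm_apply_apply, (opK_of_comm _ _).2 h1, map_zero]
    have hNO : hsS (opN (fun m => L m t)) (hsJ d O) = 0 := by
      rw [hsS_apply, LinearEquiv.symm_apply_apply, opN_of_comm _ _ h2, map_zero]
    have a1 := hK t ht (hsJ d O + x)
    rw [map_add, hKO, zero_add, inner_add_left, hK t ht x, add_zero] at a1
    have a2 := hsym t ht (hsJ d O) x
    rw [hNO, inner_zero_left] at a2
    rw [hG, _root_.sub_apply, inner_sub_right, a1, ← a2, sub_zero]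
  have hG0 : ∀ t, 0 ≤ t → ∀ x ∈ cInt U L, G t x = 0 := by
    intro t ht x hx
    obtain ⟨h1, h2⟩ := hC _ hx
    rw [hG, _root_.sub_apply, hsS_apply, hsS_apply, (opK_of_comm _ _).2 (h1 t ht),
      opN_of_comm _ _ (fun m => h2 m t ht), map_zero, sub_zero]
  set r : ℝ → EuclideanSpace ℂ (Fin d × Fin d) := fun t => hsJ d (ρ t) with hr
  have hrd : ∀ t, 0 ≤ t → HasDerivAt r (G t (r t)) t := by
    intro t ht
    rw [hr, hGJ]
    exact hsJ_deriv (hρ t ht)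
  obtain ⟨c, hc, w, hw, hcw⟩ := (cInt U L).exists_add_mem_mem_orthogonal (r 0)
  set A : ℝ → EuclideanSpace ℂ (Fin d × Fin d) := fun t => r t - c with hA
  have hAd : ∀ t, 0 ≤ t → HasDerivAt A (G t (A t)) t := by
    intro t ht
    have := (hrd t ht).sub_const c
    refine this.congr_deriv ?_
    rw [hA, map_sub, hG0 t ht c hc, sub_zero]
  have hAV : ∀ t, 0 ≤ t → A t ∈ (cInt U L)ᗮ := by
    intro t ht
    rw [Submodule.mem_orthogonal]
    intro x hx
    have hd : ∀ s, 0 ≤ s → HasDerivAt (fun s => inner ℝ x (A s)) 0 s := by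
      intro s hs
      have h1 := ((hasDerivAt_const s x).inner ℝ (hAd s hs))
      refine h1.congr_deriv ?_
      obtain ⟨h1, h2⟩ := hC _ hx
      have := hGi s hs _ (h1 s hs) (fun m => h2 m s hs) (A s)
      rw [LinearEquiv.apply_symm_apply] at this
      rw [this, inner_zero_left, add_zero]
    have h2 := constant_of_has_deriv_right_zero (f := fun s => inner ℝ x (A s)) (a := 0) (b := t)
      (fun s hs => (hd s hs.1).continuousAt.continuousWithinAt)
      (fun s hs => (hd s hs.1).hasDerivWithinAt) t ⟨ht, le_rfl⟩
    have h3 : A 0 = w := by rw [hA]; simp only; rw [hcw]; abel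
    change inner ℝ x (A t) = inner ℝ x (A 0) at h2
    rw [h2, h3]
    exact (Submodule.mem_orthogonal _ _).1 hw x hx
  have hlim : Tendsto A atTop (nhds 0) := by
    refine aux_decay G (fun t => hsS (opK (H t))) (fun t => hsS (opN (fun m => L m t)))
      (fun t => hsS (opW (U t))) (fun t => hsS (opW ((U t)ᴴ))) B hB hGB hGc hGrec ?_ hK hsym hpos
      ?_ ?_ ?_ ?_ ?_ ?_ (cInt U L)ᗮ ?_ A hAV hAd
    · intro t x
      rw [hG, _root_.sub_apply]
    · intro t ht x
      rw [hsS_apply, hsS_apply, LinearEquiv.symm_apply_apply]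
      simp only [opW, LinearMap.coe_mk, AddHom.coe_mk, Matrix.conjTranspose_conjTranspose]
      have e : ∀ X : Matrix (Fin d) (Fin d) ℂ, U t * ((U t)ᴴ * X * U t) * (U t)ᴴ
          = (U t * (U t)ᴴ) * X * (U t * (U t)ᴴ) := by
        intro X
        simp only [Matrix.mul_assoc]
      rw [e, hUU' t ht, Matrix.one_mul, Matrix.mul_one, LinearEquiv.apply_symm_apply]
    · intro t ht x
      rw [hsS_apply, opW_norm _ _ (hUU t ht), LinearEquiv.apply_symm_apply]
    · intro t ht x
      rw [hsS_apply, opW_norm _ _ (by simpa using hUU' t ht), LinearEquiv.apply_symm_apply]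
    · intro x
      rw [hsS_apply, hU0]
      simp [opW]
    · intro x t ht
      have := hsJ_deriv (opW_deriv2 H U hH hU ((hsJ d).symm x) t ht)
      exact this.continuousAt.continuousWithinAt
    · intro y y' t ht hy
      have := hsJ_deriv (opW_deriv H U hH hU _ _ t ht (hsJ_symm_deriv hy))
      refine this.congr_deriv ?_
      rw [hsS_apply, hsS_apply, map_sub (hsJ d).symm, LinearEquiv.symm_apply_apply]
    · intro b hb hbN
      have hbC : b ∈ cInt U L := by
        intro m t ht
        rw [comm_iff _ _ _ (hUU t ht) (hUU' t ht)]
        have h1 := hbN t ht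
        simp only [hsS_apply, LinearEquiv.symm_apply_apply, map_eq_zero_iff _ (hsJ d).injective]
          at h1
        refine opN_zero_comm (fun m => L m t) (fun m => hL m t ht) _ ?_ m
        rw [h1]
        simp
      have := (Submodule.mem_orthogonal _ _).1 hb b hbC
      exact inner_self_eq_zero.1 this
  have hr2 : Tendsto r atTop (nhds c) := by
    have := hlim.add_const c
    simpa [hA] using this
  refine ⟨(hsJ d).symm c, ?_⟩
  have := (hsJ_symm_cont.tendsto c).comp hr2
  simpa [hr, Function.comp_def] using this

/-- A non-stationary positive element of the interaction commutant. -/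
theorem exists_psd (H : ℝ → Matrix (Fin d) (Fin d) ℂ)
    (L : Fin M → ℝ → Matrix (Fin d) (Fin d) ℂ)
    (hL : ∀ m, ∀ t : ℝ, 0 ≤ t → (L m t).IsHermitian)
    (U : ℝ → Matrix (Fin d) (Fin d) ℂ)
    (O : Matrix (Fin d) (Fin d) ℂ)
    (hO : ∀ m, ∀ t : ℝ, 0 ≤ t → Commute ((U t)ᴴ * L m t * U t) O)
    (hn : ¬ ((∀ t : ℝ, 0 ≤ t → Commute (H t) O) ∧
            ∀ m, ∀ t : ℝ, 0 ≤ t → Commute (L m t) O)) :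
    ∃ ρ0 : Matrix (Fin d) (Fin d) ℂ, IsDensity ρ0 ∧
      (∀ m, ∀ t : ℝ, 0 ≤ t → Commute ((U t)ᴴ * L m t * U t) ρ0) ∧
      ¬ ((∀ t : ℝ, 0 ≤ t → Commute (H t) ρ0) ∧
            ∀ m, ∀ t : ℝ, 0 ≤ t → Commute (L m t) ρ0) := by
  set Z : ℂ → Matrix (Fin d) (Fin d) ℂ := fun ω => (1 + ω • O)ᴴ * (1 + ω • O) with hZ
  have hpol : O = (4⁻¹ : ℂ) • (Z 1 - Z (-1) + (-Complex.I) • Z Complex.I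
      + Complex.I • Z (-Complex.I)) := by
    have e : ∀ ω : ℂ, Z ω = 1 + ω • O + star ω • Oᴴ + (star ω * ω) • (Oᴴ * O) := by
      intro ω
      simp only [hZ, Matrix.conjTranspose_add, Matrix.conjTranspose_one, Matrix.conjTranspose_smul,
        Matrix.add_mul, Matrix.mul_add, Matrix.one_mul, Matrix.mul_one, Matrix.smul_mul,
        Matrix.mul_smul, smul_smul, smul_add]
      rw [mul_comm (star ω) ω]
      abel
    have hI : Complex.I * Complex.I = -1 := Complex.I_mul_I
    simp only [e, star_one, star_neg, Complex.star_def, Complex.conj_I]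
    match_scalars <;> ring_nf <;> simp [Complex.I_sq] <;> norm_num
  have hOs : ∀ m, ∀ t : ℝ, 0 ≤ t → Commute ((U t)ᴴ * L m t * U t) Oᴴ := by
    intro m t ht
    have h1 := (hO m t ht).eq
    have h2 := congrArg Matrix.conjTranspose h1
    simp only [Matrix.conjTranspose_mul, (hL m t ht).eq, Matrix.conjTranspose_conjTranspose] at h2
    simp only [Commute, SemiconjBy, Matrix.mul_assoc] at h2 ⊢
    exact h2.symm
  have hZI : ∀ ω, ∀ m, ∀ t : ℝ, 0 ≤ t → Commute ((U t)ᴴ * L m t * U t) (Z ω) := by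
    intro ω m t ht
    simp only [hZ, Matrix.conjTranspose_add, Matrix.conjTranspose_one, Matrix.conjTranspose_smul]
    exact ((Commute.one_right _).add_right ((hOs m t ht).smul_right _)).mul_right
      ((Commute.one_right _).add_right ((hO m t ht).smul_right _))
  obtain ⟨ω, hω⟩ : ∃ ω, ¬ ((∀ t : ℝ, 0 ≤ t → Commute (H t) (Z ω)) ∧
            ∀ m, ∀ t : ℝ, 0 ≤ t → Commute (L m t) (Z ω)) := by
    by_contra hcon
    push Not at hcon
    apply hn
    have gen : ∀ P : Matrix (Fin d) (Fin d) ℂ, (∀ ω, Commute P (Z ω)) → Commute P O := by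
      intro P hP
      rw [hpol]
      exact ((((hP _).sub_right (hP _)).add_right ((hP _).smul_right _)).add_right
        ((hP _).smul_right _)).smul_right _
    exact ⟨fun t ht => gen _ (fun ω => (hcon ω).1 t ht),
      fun m t ht => gen _ (fun ω => (hcon ω).2 m t ht)⟩
  have hpsd : (Z ω).PosSemidef := Matrix.posSemidef_conjTranspose_mul_self _
  have htr : Matrix.trace (Z ω) ≠ 0 := by
    intro h0
    have h1 : (1 + ω • O) = 0 := Matrix.trace_conjTranspose_mul_self_eq_zero_iff.1 h0
    apply hω
    have : Z ω = 0 := by simp only [hZ]; rw [h1]; simp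
    rw [this]
    exact ⟨fun t _ => Commute.zero_right _, fun m t _ => Commute.zero_right _⟩
  have hback : ∀ P : Matrix (Fin d) (Fin d) ℂ,
      Commute P ((Matrix.trace (Z ω))⁻¹ • Z ω) → Commute P (Z ω) := by
    intro P hP
    have := hP.smul_right (Matrix.trace (Z ω))
    rwa [smul_smul, mul_inv_cancel₀ htr, one_smul] at this
  refine ⟨(Matrix.trace (Z ω))⁻¹ • Z ω, ⟨?_, ?_⟩, ?_, ?_⟩
  · refine hpsd.smul ?_
    have := hpsd.trace_nonneg
    exact inv_nonneg.2 this
  · rw [Matrix.trace_smul, smul_eq_mul, inv_mul_cancel₀ htr]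
  · intro m t ht
    exact (hZI ω m t ht).smul_right _
  · rintro ⟨h1, h2⟩
    exact hω ⟨fun t ht => hback _ (h1 t ht), fun m t ht => hback _ (h2 m t ht)⟩

end Main

/-- existence of a time-dependent steady state iff `C^Int \ C^Sch ≠ ∅`. -/
theorem stmt4 {d M : ℕ} (hd : 0 < d)
    (H : ℝ → Matrix (Fin d) (Fin d) ℂ)
    (L : Fin M → ℝ → Matrix (Fin d) (Fin d) ℂ)
    (hH : ∀ t : ℝ, 0 ≤ t → (H t).IsHermitian)
    (hL : ∀ m, ∀ t : ℝ, 0 ≤ t → (L m t).IsHermitian)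
    (hHcont : Continuous H)
    (hQ : CondQ (gksl H L))
    (U : ℝ → Matrix (Fin d) (Fin d) ℂ)
    (hU0 : U 0 = 1)
    (hU : ∀ t : ℝ, 0 ≤ t → HasDerivAt U ((-Complex.I) • (H t * U t)) t) :
    (∃ O : Matrix (Fin d) (Fin d) ℂ,
        (∀ m, ∀ t : ℝ, 0 ≤ t → Commute ((U t)ᴴ * L m t * U t) O) ∧
        ¬ ((∀ t : ℝ, 0 ≤ t → Commute (H t) O) ∧
            ∀ m, ∀ t : ℝ, 0 ≤ t → Commute (L m t) O))
      ↔
    (∃ ρ0 : Matrix (Fin d) (Fin d) ℂ, IsDensity ρ0 ∧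
      ∃ ρ : ℝ → Matrix (Fin d) (Fin d) ℂ, ρ 0 = ρ0 ∧
        (∀ t : ℝ, 0 ≤ t → HasDerivAt ρ (gksl H L t (ρ t)) t) ∧
        ∃ ρs : ℝ → Matrix (Fin d) (Fin d) ℂ,
          (∀ t : ℝ, 0 ≤ t → IsDensity (ρs t)) ∧
          Tendsto (fun t => ρ t - ρs t) atTop (nhds 0) ∧
          ∀ σ : Matrix (Fin d) (Fin d) ℂ, IsDensity σ → ¬ Tendsto ρs atTop (nhds σ)) := by
  have hUU : ∀ t, 0 ≤ t → (U t)ᴴ * U t = 1 := by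
    intro t ht
    simpa using unitary_of_deriv H U hH hU0 hU 1 (fun s _ => Commute.one_right _) t ht
  have hUU' : ∀ t, 0 ≤ t → U t * (U t)ᴴ = 1 := fun t ht => mul_eq_one_comm.1 (hUU t ht)
  constructor
  · rintro ⟨O, hO, hn⟩
    obtain ⟨ρ0, hρ0, hI, hS⟩ := exists_psd H L hL U O hO hn
    have hsol : ∀ t : ℝ, 0 ≤ t →
        HasDerivAt (fun s => opW (U s) ρ0) (gksl H L t (opW (U t) ρ0)) t := by
      intro t ht
      refine (opW_deriv2 H U hH hU ρ0 t ht).congr_deriv ?_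
      rw [gksl_eq, LinearMap.sub_apply, opN_of_comm, sub_zero]
      intro m
      exact (comm_iff _ _ _ (hUU t ht) (hUU' t ht)).1 (hI m t ht)
    refine ⟨ρ0, hρ0, fun s => opW (U s) ρ0, by simp [opW, hU0], hsol,
      fun s => opW (U s) ρ0, ?_, by simp, ?_⟩
    · intro t ht
      refine ⟨hρ0.1.mul_mul_conjTranspose_same (U t), ?_⟩
      simp only [opW, LinearMap.coe_mk, AddHom.coe_mk]
      rw [Matrix.trace_mul_comm, ← Matrix.mul_assoc, hUU t ht, Matrix.one_mul]
      exact hρ0.2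
    · intro σ _ hlim
      obtain ⟨G, hG, hGJ, B, hB, hGB, hGc, hGrec⟩ := condQ_transport H L hQ
      have hz : ∀ s, 0 ≤ s → gksl H L s σ = 0 := by
        intro s hs
        have := aux_limit_zero G B hB hGB hGc hGrec (fun t => hsJ d (opW (U t) ρ0))
          (fun t ht => by rw [hGJ]; exact hsJ_deriv (hsol t ht)) (hsJ d σ)
          ((hsJ_cont.tendsto σ).comp hlim) s hs
        rw [hGJ] at this
        simpa using this
      have hLσ : ∀ m, ∀ t : ℝ, 0 ≤ t → Commute (L m t) σ := by
        intro m t ht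
        refine opN_zero_comm (fun m => L m t) (fun m => hL m t ht) σ ?_ m
        have h1 := hz t ht
        rw [gksl_eq, LinearMap.sub_apply, sub_eq_zero] at h1
        rw [← h1]
        exact opK_inner _ (hH t ht) σ
      have hHσ : ∀ t : ℝ, 0 ≤ t → Commute (H t) σ := by
        intro t ht
        have h1 := hz t ht
        rw [gksl_eq, LinearMap.sub_apply, opN_of_comm _ _ (fun m => hLσ m t ht), sub_zero] at h1
        exact (opK_of_comm _ _).1 h1
      have hconst : ∀ t, 0 ≤ t → ‖hsJ d (opW (U t) ρ0 - σ)‖ = ‖hsJ d (ρ0 - σ)‖ := by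
        intro t ht
        have h1 := unitary_of_deriv H U hH hU0 hU σ hHσ t ht
        have h2 : opW (U t) σ = σ := by
          simp only [opW, LinearMap.coe_mk, AddHom.coe_mk]
          calc U t * σ * (U t)ᴴ = U t * ((U t)ᴴ * σ * U t) * (U t)ᴴ := by rw [h1]
            _ = (U t * (U t)ᴴ) * σ * (U t * (U t)ᴴ) := by simp only [Matrix.mul_assoc]
            _ = σ := by rw [hUU' t ht, Matrix.one_mul, Matrix.mul_one]
        calc _ = ‖hsJ d (opW (U t) (ρ0 - σ))‖ := by rw [map_sub (opW (U t)), h2]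
          _ = _ := opW_norm _ _ (hUU t ht)
      have hlim2 : Tendsto (fun t => ‖hsJ d (opW (U t) ρ0 - σ)‖) atTop (nhds 0) := by
        have h1 : Tendsto (fun t => opW (U t) ρ0 - σ) atTop (nhds 0) := by
          simpa using hlim.sub_const σ
        have h2 := ((hsJ_cont.tendsto (0 : Matrix (Fin d) (Fin d) ℂ)).comp h1).norm
        simpa using h2
      have hz0 : ‖hsJ d (ρ0 - σ)‖ = 0 := by
        refine tendsto_nhds_unique (tendsto_const_nhds.congr' ?_) hlim2
        filter_upwards [eventually_ge_atTop 0] with t ht using (hconst t ht).symm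
      have heq : ρ0 = σ := by
        rw [norm_eq_zero, map_eq_zero_iff _ (hsJ d).injective] at hz0
        exact sub_eq_zero.1 hz0
      rw [heq] at hS
      exact hS ⟨hHσ, hLσ⟩
  · rintro ⟨ρ0, _, ρ, _, hρ, ρs, hρs, hlim, hnc⟩
    by_contra hcon
    push Not at hcon
    obtain ⟨σ, hσ⟩ := solution_converges H L hH hL hQ U hU0 hU hcon ρ hρ
    have h1 : Tendsto ρs atTop (nhds σ) := by
      simpa using hσ.sub hlim
    exact hnc σ (density_closed hρs h1) h1
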